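/- Under the setting of the extension lemma (Lemma on $\partial_Q\Phi$), let $\Phi_\lambda$ denote the modified Moreau–Yosida regularization of $\Phi$ in $\mathcal{V} = L^{p(x)}(Q)$ and $\varphi_\lambda$ that of $\varphi$ in $V = L^{p(x)}(\Omega)$. Then $\Phi_\lambda(u) = \int_0^T \varphi_\lambda(Pu(t))\,dt$ for all $u \in \mathcal{V}$; i.e., Moreau–Yosida regularization and integration in time commute in the variable exponent setting. -/

import Mathlib

open MeasureTheory Filter Set
open scoped ENNReal Topology

noncomputable section

/-- The modular of a variable exponent Lebesgue space. -/
def vModular {α : Type*} [MeasurableSpace α] (μ : Measure α) (p : α → ℝ) (u : α → ℝ) : ℝ≥0∞ :=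
  ∫⁻ x, ENNReal.ofReal (|u x| ^ p x) ∂μ

/-- Membership in the variable exponent Lebesgue space `L^{p(x)}`. -/
def MemVLp {α : Type*} [MeasurableSpace α] (μ : Measure α) (p : α → ℝ) (u : α → ℝ) : Prop :=
  AEMeasurable u μ ∧ vModular μ p u < ⊤

/-- The Luxemburg norm on the variable exponent Lebesgue space. -/
def luxNorm {α : Type*} [MeasurableSpace α] (μ : Measure α) (p : α → ℝ) (u : α → ℝ) : ℝ :=
  sInf {lam : ℝ | 0 < lam ∧ vModular μ p (fun x => u x / lam) ≤ 1}

/-- The product measure on the space-time cylinder `Ω × (0,T)`. -/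
def QTmeas {N : ℕ} (Ω : Set (Fin N → ℝ)) (T : ℝ) : Measure ((Fin N → ℝ) × ℝ) :=
  (volume.restrict Ω).prod (volume.restrict (Set.Ioo (0:ℝ) T))

/-- The Mazur map `a ↦ sgn(a) |a|^q`. -/
def mz (q a : ℝ) : ℝ := (max a 0) ^ q - (max (-a) 0) ^ q

lemma mz_neg (q a : ℝ) : mz q (-a) = - mz q a := by
  simp [mz]

lemma mz_nonneg {q a : ℝ} (hq : 1 ≤ q) (ha : 0 ≤ a) : mz q a = a ^ q := by
  have : q ≠ 0 := by linarith
  simp [mz, ha, Real.zero_rpow this]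

lemma mazur_aux1 {q a b : ℝ} (hq : 1 ≤ q) (hb : 0 ≤ b) (hab : b ≤ a) :
    |a - b| ^ q ≤ 2 ^ q * |mz q a - mz q b| := by
  rw [mz_nonneg hq hb, mz_nonneg hq (hb.trans hab), abs_of_nonneg (sub_nonneg.2 hab)]
  have h := Real.add_rpow_le_rpow_add (sub_nonneg.2 hab) hb hq
  rw [sub_add_cancel] at h
  have h2 : (1:ℝ) ≤ 2 ^ q := Real.one_le_rpow (by norm_num) (by linarith)
  have h3 : 0 ≤ (a - b) ^ q := Real.rpow_nonneg (sub_nonneg.2 hab) _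
  have h4 : (a - b) ^ q ≤ |a ^ q - b ^ q| := le_trans (by linarith) (le_abs_self _)
  nlinarith [abs_nonneg (a ^ q - b ^ q)]

lemma mazur_aux2 {q a b : ℝ} (hq : 1 ≤ q) (hb : b ≤ 0) (ha : 0 ≤ a) :
    |a - b| ^ q ≤ 2 ^ q * |mz q a - mz q b| := by
  obtain ⟨c, rfl⟩ : ∃ c, b = -c := ⟨-b, by simp⟩
  have hc : 0 ≤ c := by linarith
  rw [mz_neg, mz_nonneg hq hc, mz_nonneg hq ha, sub_neg_eq_add, sub_neg_eq_add,
    abs_of_nonneg (by positivity), abs_of_nonneg (by positivity)]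
  have h1 : a + c ≤ 2 * max a c := by linarith [le_max_left a c, le_max_right a c]
  have h2 : (max a c) ^ q ≤ a ^ q + c ^ q := by
    rcases max_choice a c with h | h <;> rw [h]
    · linarith [Real.rpow_nonneg hc q]
    · linarith [Real.rpow_nonneg ha q]
  calc (a + c) ^ q ≤ (2 * max a c) ^ q :=
        Real.rpow_le_rpow (by positivity) h1 (by linarith)
    _ = 2 ^ q * (max a c) ^ q := Real.mul_rpow (by norm_num) (le_max_of_le_left ha)
    _ ≤ _ := by gcongr

lemma mazur_aux {q a b : ℝ} (hq : 1 ≤ q) (hab : b ≤ a) :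
    |a - b| ^ q ≤ 2 ^ q * |mz q a - mz q b| := by
  rcases le_total 0 b with hb | hb
  · exact mazur_aux1 hq hb hab
  · rcases le_total 0 a with ha | ha
    · exact mazur_aux2 hq hb ha
    · have := mazur_aux1 (a := -b) (b := -a) hq (by linarith) (by linarith)
      simp only [mz_neg, neg_sub_neg] at this
      exact this

lemma mazur {q : ℝ} (hq : 1 ≤ q) (a b : ℝ) :
    |a - b| ^ q ≤ 2 ^ q * |mz q a - mz q b| := by
  rcases le_total b a with h | h
  · exact mazur_aux hq h
  · rw [abs_sub_comm a b, abs_sub_comm (mz q a)]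
    exact mazur_aux hq h

lemma abs_mz_le {q : ℝ} (hq : 1 ≤ q) (a : ℝ) : |mz q a| ≤ |a| ^ q := by
  rcases le_total 0 a with h | h
  · rw [mz_nonneg hq h, abs_of_nonneg h, abs_of_nonneg (by positivity)]
  · have := mz_neg q (-a)
    rw [neg_neg] at this
    rw [this, mz_nonneg hq (by linarith), abs_neg, abs_of_nonpos h,
      abs_of_nonneg (Real.rpow_nonneg (by linarith) _)]

lemma convex_split {q Q θ : ℝ} (hq : 1 ≤ q) (hQ : q ≤ Q) (h0 : 0 < θ) (h1 : θ < 1) (a b : ℝ) :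
    |a + b| ^ q ≤ (1 - θ) ^ (1 - Q) * |a| ^ q + θ ^ (1 - Q) * |b| ^ q := by
  have h1' : 0 < 1 - θ := by linarith
  have hc := (convexOn_rpow hq).2 (x := |a| / (1 - θ)) (y := |b| / θ)
    (by simp only [mem_Ici]; positivity) (by simp only [mem_Ici]; positivity) h1'.le h0.le
    (by ring)
  simp only [smul_eq_mul] at hc
  rw [mul_div_cancel₀ _ h1'.ne', mul_div_cancel₀ _ h0.ne',
    Real.div_rpow (abs_nonneg _) h1'.le, Real.div_rpow (abs_nonneg _) h0.le] at hc
  have key : ∀ s : ℝ, 0 < s → s < 1 → ∀ c : ℝ, 0 ≤ c → s * (c / s ^ q) ≤ s ^ (1 - Q) * c := by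
    intro s hs hs1 c hc
    have e : s * (c / s ^ q) = s ^ (1 - q) * c := by
      rw [Real.rpow_sub hs, Real.rpow_one]; ring
    rw [e]
    exact mul_le_mul_of_nonneg_right
      (Real.rpow_le_rpow_of_exponent_ge hs hs1.le (by linarith)) hc
  calc |a + b| ^ q ≤ (|a| + |b|) ^ q :=
        Real.rpow_le_rpow (abs_nonneg _) (abs_add_le _ _) (by linarith)
    _ ≤ _ := hc
    _ ≤ _ := add_le_add (key _ h1' (by linarith) _ (by positivity))
        (key _ h0 h1 _ (by positivity))

/-- The integrand of the modified Moreau-Yosida penalty. -/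
def KK (lam q a : ℝ) : ℝ := lam / q * |a / lam| ^ q

lemma KK_nonneg {lam q : ℝ} (hl : 0 < lam) (hq : 1 ≤ q) (a : ℝ) : 0 ≤ KK lam q a := by
  unfold KK; positivity

lemma KK_split {lam q Q θ : ℝ} (hl : 0 < lam) (hq : 1 ≤ q) (hQ : q ≤ Q) (h0 : 0 < θ)
    (h1 : θ < 1) (a b : ℝ) :
    KK lam q (a + b) ≤ (1 - θ) ^ (1 - Q) * KK lam q a + θ ^ (1 - Q) * KK lam q b := by
  unfold KK
  have := convex_split hq hQ h0 h1 (a / lam) (b / lam)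
  rw [← add_div] at this
  have hlq : 0 ≤ lam / q := by positivity
  nlinarith [mul_le_mul_of_nonneg_left this hlq]

lemma KK_le {lam q Q : ℝ} (hl : 0 < lam) (hq : 1 ≤ q) (hQ : q ≤ Q) (a : ℝ) :
    KK lam q a ≤ lam * (1 + 1 / lam) ^ Q * |a| ^ q := by
  unfold KK
  have e : |a / lam| ^ q = (1 / lam) ^ q * |a| ^ q := by
    rw [abs_div, abs_of_pos hl, ← Real.mul_rpow (by positivity) (by positivity)]
    congr 1; ring
  rw [e, ← mul_assoc]
  have hl' : 0 < 1 / lam := by positivity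
  have h2 : (1 / lam) ^ q ≤ (1 + 1 / lam) ^ Q :=
    (Real.rpow_le_rpow hl'.le (by linarith) (by linarith)).trans
      (Real.rpow_le_rpow_of_exponent_le (by linarith) hQ)
  have h3 : lam / q ≤ lam := div_le_self hl.le hq
  gcongr

lemma le_KK {lam q Q : ℝ} (hl : 0 < lam) (hq : 1 ≤ q) (hQ : q ≤ Q) (a : ℝ) :
    |a| ^ q ≤ (1 + lam) ^ Q * Q / lam * KK lam q a := by
  unfold KK
  have hq0 : 0 < q := by linarith
  have e : |a| ^ q = lam ^ q * q / lam * (lam / q * |a / lam| ^ q) := by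
    have : |a| ^ q = lam ^ q * |a / lam| ^ q := by
      rw [abs_div, abs_of_pos hl, ← Real.mul_rpow (by positivity) (by positivity)]
      congr 1; field_simp
    rw [this]; field_simp
  have h2 : lam ^ q ≤ (1 + lam) ^ Q :=
    (Real.rpow_le_rpow hl.le (by linarith) (by linarith)).trans
      (Real.rpow_le_rpow_of_exponent_le (by linarith) hQ)
  rw [e]
  gcongr

section aux

variable {X : Type*} [MeasurableSpace X]

lemma measurable_KK {Y : Type*} [MeasurableSpace Y] (lam : ℝ) {q f : Y → ℝ}
    (hq : Measurable q) (hf : Measurable f) :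
    Measurable fun y => ENNReal.ofReal (KK lam (q y) (f y)) := by
  unfold KK
  fun_prop

lemma aemeasurable_KK {Y : Type*} [MeasurableSpace Y] {μ : Measure Y} (lam : ℝ) {q f : Y → ℝ}
    (hq : Measurable q) (hf : AEMeasurable f μ) :
    AEMeasurable (fun y => ENNReal.ofReal (KK lam (q y) (f y))) μ := by
  unfold KK
  fun_prop

lemma measurable_mz {Y : Type*} [MeasurableSpace Y] {q f : Y → ℝ}
    (hq : Measurable q) (hf : Measurable f) : Measurable fun y => mz (q y) (f y) := by
  unfold mz
  fun_prop

lemma integrable_mz {μ : Measure X} {p : X → ℝ} (hp : Measurable p) {pp : ℝ}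
    (hae : ∀ᵐ x ∂μ, 1 ≤ p x ∧ p x ≤ pp) {w : X → ℝ} (hw : Measurable w)
    (hfin : vModular μ p w < ⊤) : Integrable (fun x => mz (p x) (w x)) μ := by
  refine ⟨(measurable_mz hp hw).aestronglyMeasurable, ?_⟩
  refine lt_of_le_of_lt (lintegral_mono_ae ?_) hfin
  filter_upwards [hae] with x hx
  rw [← ofReal_norm, Real.norm_eq_abs]
  exact ENNReal.ofReal_le_ofReal (abs_mz_le hx.1 _)

/-- Countable family of test functions approximating every element of the domain of `φ`,
both in modular and in energy. -/
lemma exists_seq [MeasurableSpace.CountablyGenerated X] {μ : Measure X} [IsFiniteMeasure μ]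
    {p : X → ℝ} (hp : Measurable p) {pp : ℝ}
    (hae : ∀ᵐ x ∂μ, 1 ≤ p x ∧ p x ≤ pp) (φ : (X → ℝ) → ℝ≥0∞) (hzero : φ 0 ≠ ⊤) :
    ∃ W : ℕ → X → ℝ, (∀ n, Measurable (W n)) ∧ (∀ n, vModular μ p (W n) < ⊤) ∧
      ∀ w : X → ℝ, Measurable w → vModular μ p w < ⊤ → φ w ≠ ⊤ → ∀ ε : ℝ≥0∞, ε ≠ 0 →
        ∃ n, φ (W n) ≤ φ w + ε ∧
          ∫⁻ x, ENNReal.ofReal (|mz (p x) (W n x) - mz (p x) (w x)|) ∂μ ≤ ε := by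
  let S := {w : X → ℝ // Measurable w ∧ vModular μ p w < ⊤ ∧ φ w ≠ ⊤}
  have hint : ∀ s : S, Integrable (fun x => mz (p x) (s.1 x)) μ := fun s =>
    integrable_mz hp hae s.2.1 s.2.2.1
  have hz : vModular μ p (0 : X → ℝ) < ⊤ := by
    have : vModular μ p (0 : X → ℝ) = 0 := by
      unfold vModular
      rw [lintegral_eq_zero_iff' (by simp only [Pi.zero_apply, abs_zero]; fun_prop)]
      filter_upwards [hae] with x hx
      have : p x ≠ 0 := by linarith [hx.1]
      simp [Real.zero_rpow this]
    rw [this]; simp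
  have : Nonempty S := ⟨⟨0, measurable_zero, hz, hzero⟩⟩
  have : Fact ((1 : ℝ≥0∞) ≠ ⊤) := ⟨by simp⟩
  let G : S → (Lp ℝ 1 μ) × ℝ≥0∞ := fun s => ((hint s).toL1 _, φ s.1)
  let _ : TopologicalSpace S := TopologicalSpace.induced G inferInstance
  have : SecondCountableTopology S := TopologicalSpace.secondCountableTopology_induced _ _ G
  have hd := TopologicalSpace.denseRange_denseSeq S
  refine ⟨fun n => (TopologicalSpace.denseSeq S n).1,
    fun n => (TopologicalSpace.denseSeq S n).2.1, fun n => (TopologicalSpace.denseSeq S n).2.2.1,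
    fun w hw hwm hwφ ε hε => ?_⟩
  let s : S := ⟨w, hw, hwm, hwφ⟩
  have ho : IsOpen (G ⁻¹' (Metric.eball (G s).1 ε ×ˢ Iio (φ w + ε))) :=
    (Metric.isOpen_eball.prod isOpen_Iio).preimage continuous_induced_dom
  obtain ⟨n, hn⟩ := hd.exists_mem_open ho ⟨s, by
    refine ⟨Metric.mem_eball_self (pos_iff_ne_zero.2 hε), ?_⟩
    exact ENNReal.lt_add_right hwφ hε⟩
  refine ⟨n, le_of_lt hn.2, ?_⟩
  have h1 := hn.1
  rw [Metric.mem_eball] at h1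
  simp only [G] at h1
  rw [Integrable.edist_toL1_toL1] at h1
  refine le_trans (le_of_eq ?_) h1.le
  refine lintegral_congr fun x => ?_
  rw [edist_dist, Real.dist_eq]

/-- The penalty is continuous along the approximating family. -/
lemma approx_iInf [MeasurableSpace.CountablyGenerated X] {μ : Measure X} [IsFiniteMeasure μ]
    {p : X → ℝ} (hp : Measurable p) {pp : ℝ}
    (hae : ∀ᵐ x ∂μ, 1 ≤ p x ∧ p x ≤ pp) (φ : (X → ℝ) → ℝ≥0∞) (hzero : φ 0 ≠ ⊤)
    {lam : ℝ} (hlam : 0 < lam) :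
    ∃ W : ℕ → X → ℝ, (∀ n, Measurable (W n)) ∧ (∀ n, vModular μ p (W n) < ⊤) ∧
      ∀ w : X → ℝ, Measurable w → vModular μ p w < ⊤ → ∀ u : X → ℝ, Measurable u →
        ⨅ n, ((∫⁻ x, ENNReal.ofReal (KK lam (p x) (W n x - u x)) ∂μ) + φ (W n)) ≤
          (∫⁻ x, ENNReal.ofReal (KK lam (p x) (w x - u x)) ∂μ) + φ w := by
  obtain ⟨W, hW, hWm, hWa⟩ := exists_seq hp hae φ hzero
  refine ⟨W, hW, hWm, fun w hw hwm u hu => ?_⟩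
  by_cases hφ : φ w = ⊤
  · simp [hφ]
  set A := ∫⁻ x, ENNReal.ofReal (KK lam (p x) (w x - u x)) ∂μ with hA
  by_cases hAt : A = ⊤
  · simp [hAt]
  have hbound : ∀ θ : ℝ, 0 < θ → θ < 1 → ∀ n,
      ∫⁻ x, ENNReal.ofReal (KK lam (p x) (W n x - u x)) ∂μ ≤
        ENNReal.ofReal ((1 - θ) ^ (1 - pp)) * A +
        ENNReal.ofReal (θ ^ (1 - pp) * (lam * (1 + 1 / lam) ^ pp * 2 ^ pp)) *
          ∫⁻ x, ENNReal.ofReal (|mz (p x) (W n x) - mz (p x) (w x)|) ∂μ := by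
    intro θ h0 h1 n
    have h1' : 0 < 1 - θ := by linarith
    have hm : Measurable fun x => ENNReal.ofReal (KK lam (p x) (w x - u x)) :=
      measurable_KK lam hp (hw.sub hu)
    rw [hA, ← lintegral_const_mul _ hm,
      ← lintegral_const_mul' _ _ ENNReal.ofReal_ne_top, ← lintegral_add_left
      (hm.const_mul _)]
    refine lintegral_mono_ae ?_
    filter_upwards [hae] with x hx
    have hKn := KK_nonneg hlam hx.1 (w x - u x)
    rw [← ENNReal.ofReal_mul (by positivity), ← ENNReal.ofReal_mul (by positivity),
      ← ENNReal.ofReal_add (by positivity) (by positivity)]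
    apply ENNReal.ofReal_le_ofReal
    have e : W n x - u x = (w x - u x) + (W n x - w x) := by ring
    rw [e]
    refine (KK_split hlam hx.1 hx.2 h0 h1 _ _).trans ?_
    refine add_le_add le_rfl ?_
    rw [mul_assoc (θ ^ (1 - pp))]
    refine mul_le_mul_of_nonneg_left ?_ (by positivity)
    refine (KK_le hlam hx.1 hx.2 _).trans ?_
    rw [mul_assoc _ (2 ^ pp)]
    gcongr
    refine (mazur hx.1 _ _).trans ?_
    gcongr
    · norm_num
    · exact hx.2
  refine ENNReal.le_of_forall_pos_le_add fun ε hε _ => ?_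
  have hε3 : ((ε / 3 : NNReal) : ℝ≥0∞) ≠ 0 := by
    simp [hε.ne']
  obtain ⟨θ, h0, h1, hθ⟩ : ∃ θ : ℝ, 0 < θ ∧ θ < 1 ∧
      ENNReal.ofReal ((1 - θ) ^ (1 - pp)) * A ≤ A + (ε / 3 : NNReal) := by
    have hc : Tendsto (fun θ : ℝ => ENNReal.ofReal ((1 - θ) ^ (1 - pp)) * A) (𝓝[>] 0)
        (𝓝 (1 * A)) := by
      refine ENNReal.Tendsto.mul_const ?_ (Or.inr hAt)
      have : Tendsto (fun θ : ℝ => (1 - θ) ^ (1 - pp)) (𝓝 0) (𝓝 1) := by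
        have hca : ContinuousAt (fun θ : ℝ => (1 - θ) ^ (1 - pp)) 0 :=
          ContinuousAt.rpow_const (by fun_prop) (Or.inl (by norm_num))
        have := hca.tendsto
        simpa using this
      have := ENNReal.tendsto_ofReal this
      rw [ENNReal.ofReal_one] at this
      exact this.mono_left nhdsWithin_le_nhds
    rw [one_mul] at hc
    have e1 := hc.eventually_lt_const (ENNReal.lt_add_right hAt hε3)
    have e2 : ∀ᶠ θ : ℝ in 𝓝[>] 0, θ ∈ Ioo (0:ℝ) 1 := Ioo_mem_nhdsGT (by norm_num)
    obtain ⟨θ, hh1, hh2⟩ := (e1.and e2).exists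
    exact ⟨θ, hh2.1, hh2.2, hh1.le⟩
  set C := ENNReal.ofReal (θ ^ (1 - pp) * (lam * (1 + 1 / lam) ^ pp * 2 ^ pp)) with hC
  have hCt : C ≠ ⊤ := ENNReal.ofReal_ne_top
  obtain ⟨δ, hδ0, hδ⟩ : ∃ δ : ℝ≥0∞, δ ≠ 0 ∧ δ ≤ (ε / 3 : NNReal) ∧ C * δ ≤ (ε / 3 : NNReal) := by
    refine ⟨min (ε / 3 : NNReal) ((ε / 3 : NNReal) / C), ?_, min_le_left _ _, ?_⟩
    · rw [← pos_iff_ne_zero, lt_min_iff]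
      exact ⟨pos_iff_ne_zero.2 hε3, ENNReal.div_pos hε3 hCt⟩
    · exact (mul_le_mul_right (min_le_right _ _) _).trans ENNReal.mul_div_le
  obtain ⟨n, hn1, hn2⟩ := hWa w hw hwm hφ δ hδ0
  refine (iInf_le _ n).trans ?_
  calc _ ≤ ((A + (ε / 3 : NNReal)) + (ε / 3 : NNReal)) + (φ w + (ε / 3 : NNReal)) := by
        refine add_le_add ((hbound θ h0 h1 n).trans (add_le_add hθ ?_)) ?_
        · exact (mul_le_mul_right hn2 _).trans hδ.2
        · exact hn1.trans (by gcongr; exact hδ.1)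
    _ = A + φ w + ((ε / 3 : NNReal) + (ε / 3 : NNReal) + (ε / 3 : NNReal)) := by ring
    _ = A + φ w + ε := by
        rw [← ENNReal.coe_add, ← ENNReal.coe_add, add_thirds]

end aux

section main

variable {X : Type*} [MeasurableSpace X]

lemma upper_bound [MeasurableSpace.CountablyGenerated X] {μ : Measure X} [IsFiniteMeasure μ]
    {ν : Measure ℝ} [IsFiniteMeasure ν]
    {p : X → ℝ} (hp : Measurable p) {pp : ℝ}
    (hae : ∀ᵐ x ∂μ, 1 ≤ p x ∧ p x ≤ pp) (φ : (X → ℝ) → ℝ≥0∞) (hzero : φ 0 ≠ ⊤)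
    (hinv : ∀ w, MemVLp μ p w → ∀ w', Measurable w' → w =ᵐ[μ] w' → φ w' ≤ φ w)
    {lam : ℝ} (hlam : 0 < lam) (u : X × ℝ → ℝ) (hu : Measurable u)
    (hum : vModular (μ.prod ν) (fun z => p z.1) u < ⊤) :
    (⨅ v ∈ {v : X × ℝ → ℝ | MemVLp (μ.prod ν) (fun z => p z.1) v},
      (∫⁻ z, ENNReal.ofReal (KK lam (p z.1) (v z - u z)) ∂(μ.prod ν)) +
        ∫⁻ t, (φ fun x => v (x, t)) ∂ν)
    ≤ ∫⁻ t, (⨅ w ∈ {w : X → ℝ | MemVLp μ p w},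
          (∫⁻ x, ENNReal.ofReal (KK lam (p x) (w x - u (x, t))) ∂μ) + φ w) ∂ν := by
  obtain ⟨W, hW, hWm, hWa⟩ := approx_iInf hp hae φ hzero hlam
  refine ENNReal.le_of_forall_pos_le_add fun ε hε hfin => ?_
  set g : ℕ → ℝ → ℝ≥0∞ := fun n t =>
    (∫⁻ x, ENNReal.ofReal (KK lam (p x) (W n x - u (x, t))) ∂μ) + φ (W n) with hg
  have hgm : ∀ n, Measurable (g n) := by
    intro n
    refine Measurable.add_const ?_ _
    have h1 : Measurable fun z : X × ℝ => ENNReal.ofReal (KK lam (p z.1) (W n z.1 - u z)) :=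
      measurable_KK lam (hp.comp measurable_fst) (((hW n).comp measurable_fst).sub hu)
    exact h1.lintegral_prod_left'
  set h : ℝ → ℝ≥0∞ := fun t => ⨅ n, g n t with hh
  have hhm : Measurable h := Measurable.iInf hgm
  have hle : ∀ t, h t ≤ ⨅ w ∈ {w : X → ℝ | MemVLp μ p w},
          (∫⁻ x, ENNReal.ofReal (KK lam (p x) (w x - u (x, t))) ∂μ) + φ w := by
    intro t
    refine le_iInf₂ fun w hw => ?_
    have hw' : MemVLp μ p w := hw
    have hwe := hw'.1.ae_eq_mk
    have hmk : vModular μ p (hw'.1.mk w) < ⊤ := by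
      refine lt_of_le_of_lt (le_of_eq ?_) hw'.2
      unfold vModular
      refine lintegral_congr_ae ?_
      filter_upwards [hwe] with x hx
      rw [hx]
    refine (hWa _ hw'.1.measurable_mk hmk (fun x => u (x, t))
      (hu.comp measurable_prodMk_right)).trans ?_
    refine add_le_add (le_of_eq ?_) (hinv w hw' _ hw'.1.measurable_mk hwe)
    refine lintegral_congr_ae ?_
    filter_upwards [hwe] with x hx
    rw [hx]
  obtain ⟨η, hη0, hη⟩ : ∃ η : ℝ≥0∞, η ≠ 0 ∧ η * ν univ ≤ ε := by
    refine ⟨ε / ν univ, (ENNReal.div_pos (by simpa using hε.ne') (measure_ne_top _ _)).ne', ?_⟩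
    rw [mul_comm]
    exact ENNReal.mul_div_le
  have hex : ∀ t, ∃ n, g n t ≤ h t + η := by
    intro t
    by_cases ht : h t = ⊤
    · exact ⟨0, by simp [ht]⟩
    · obtain ⟨n, hn⟩ := iInf_lt_iff.1 (ENNReal.lt_add_right ht hη0)
      exact ⟨n, hn.le⟩
  classical
  let m : ℝ → ℕ := fun t => Nat.find (hex t)
  have hmm : Measurable m :=
    measurable_find hex fun n => measurableSet_le (hgm n) (hhm.add_const _)
  have hms : ∀ t, g (m t) t ≤ h t + η := fun t => Nat.find_spec (hex t)
  let v : X × ℝ → ℝ := fun z => W (m z.2) z.1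
  have hv : Measurable v := by
    have h1 : Measurable fun y : X × ℕ => W y.2 y.1 :=
      measurable_from_prod_countable_left fun n => hW n
    exact h1.comp (measurable_fst.prodMk (hmm.comp measurable_snd))
  have hpz : Measurable fun z : X × ℝ => p z.1 := hp.comp measurable_fst
  have hKm : Measurable fun z : X × ℝ => ENNReal.ofReal (KK lam (p z.1) (v z - u z)) :=
    measurable_KK lam hpz (hv.sub hu)
  have htotal : (∫⁻ z, ENNReal.ofReal (KK lam (p z.1) (v z - u z)) ∂(μ.prod ν)) +
        ∫⁻ t, (φ fun x => v (x, t)) ∂ν ≤ (∫⁻ t, (⨅ w ∈ {w : X → ℝ | MemVLp μ p w},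
          (∫⁻ x, ENNReal.ofReal (KK lam (p x) (w x - u (x, t))) ∂μ) + φ w) ∂ν) + ε := by
    rw [lintegral_prod_symm' _ hKm, ← lintegral_add_left hKm.lintegral_prod_left']
    calc _ ≤ ∫⁻ t, (h t + η) ∂ν := lintegral_mono fun t => hms t
      _ = (∫⁻ t, h t ∂ν) + η * ν univ := by
        rw [lintegral_add_right _ measurable_const, lintegral_const]
      _ ≤ _ := add_le_add (lintegral_mono hle) hη
  refine (iInf₂_le v ?_).trans htotal
  have hK : ∫⁻ z, ENNReal.ofReal (KK lam (p z.1) (v z - u z)) ∂(μ.prod ν) < ⊤ :=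
    lt_of_le_of_lt (le_self_add.trans htotal) (ENNReal.add_lt_top.2 ⟨hfin, by simp⟩)
  refine ⟨hv.aemeasurable, ?_⟩
  have haez : ∀ᵐ z ∂(μ.prod ν), 1 ≤ p z.1 ∧ p z.1 ≤ pp :=
    Measure.quasiMeasurePreserving_fst.ae hae
  set c : ℝ := (1 / 2) ^ (1 - pp) with hc
  have hc0 : 0 < c := by positivity
  set D : ℝ := (1 + lam) ^ pp * pp / lam with hD
  have hbd : vModular (μ.prod ν) (fun z => p z.1) v ≤
      ENNReal.ofReal (c * |D|) * (∫⁻ z, ENNReal.ofReal (KK lam (p z.1) (v z - u z)) ∂(μ.prod ν)) +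
      ENNReal.ofReal c * vModular (μ.prod ν) (fun z => p z.1) u := by
    unfold vModular
    rw [← lintegral_const_mul' _ _ ENNReal.ofReal_ne_top,
      ← lintegral_const_mul' _ _ ENNReal.ofReal_ne_top, ← lintegral_add_left (hKm.const_mul _)]
    refine lintegral_mono_ae ?_
    filter_upwards [haez] with z hz
    have hKn := KK_nonneg hlam hz.1 (v z - u z)
    rw [← ENNReal.ofReal_mul (by positivity), ← ENNReal.ofReal_mul (by positivity),
      ← ENNReal.ofReal_add (by positivity) (by positivity)]
    apply ENNReal.ofReal_le_ofReal
    have h1 := convex_split hz.1 hz.2 (θ := 1 / 2) (by norm_num) (by norm_num) (v z - u z) (u z)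
    rw [sub_add_cancel, show (1 - 1 / 2 : ℝ) = 1 / 2 by norm_num] at h1
    refine h1.trans ?_
    rw [← hc, mul_assoc]
    gcongr
    refine (le_KK hlam hz.1 hz.2 _).trans ?_
    rw [← hD]
    gcongr
    exact le_abs_self _
  refine lt_of_le_of_lt hbd (ENNReal.add_lt_top.2 ⟨?_, ?_⟩)
  · exact ENNReal.mul_lt_top ENNReal.ofReal_lt_top hK
  · exact ENNReal.mul_lt_top ENNReal.ofReal_lt_top hum

lemma ae_ae_swap {μ : Measure X} [IsFiniteMeasure μ] {ν : Measure ℝ} [IsFiniteMeasure ν]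
    {P : X × ℝ → Prop} (h : ∀ᵐ z ∂(μ.prod ν), P z) : ∀ᵐ t ∂ν, ∀ᵐ x ∂μ, P (x, t) := by
  have h2 : ∀ᵐ z ∂(ν.prod μ), P z.swap :=
    (Measure.measurePreserving_swap (μ := ν) (ν := μ)).quasiMeasurePreserving.ae h
  exact Measure.ae_ae_of_ae_prod h2

lemma lower_bound {μ : Measure X} [IsFiniteMeasure μ]
    {ν : Measure ℝ} [IsFiniteMeasure ν]
    {p : X → ℝ} (hp : Measurable p) (φ : (X → ℝ) → ℝ≥0∞)
    {lam : ℝ} (u : X × ℝ → ℝ) (hu : AEMeasurable u (μ.prod ν)) :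
    ∫⁻ t, (⨅ w ∈ {w : X → ℝ | MemVLp μ p w},
          (∫⁻ x, ENNReal.ofReal (KK lam (p x) (w x - u (x, t))) ∂μ) + φ w) ∂ν ≤
    (⨅ v ∈ {v : X × ℝ → ℝ | MemVLp (μ.prod ν) (fun z => p z.1) v},
      (∫⁻ z, ENNReal.ofReal (KK lam (p z.1) (v z - u z)) ∂(μ.prod ν)) +
        ∫⁻ t, (φ fun x => v (x, t)) ∂ν) := by
  refine le_iInf₂ fun v hv => ?_
  have hv' : MemVLp (μ.prod ν) (fun z => p z.1) v := hv
  have hpz : Measurable fun z : X × ℝ => p z.1 := hp.comp measurable_fst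
  have hKm : AEMeasurable (fun z : X × ℝ => ENNReal.ofReal (KK lam (p z.1) (v z - u z)))
      (μ.prod ν) := aemeasurable_KK lam hpz (hv'.1.sub hu)
  rw [lintegral_prod_symm _ hKm, ← lintegral_add_left' hKm.lintegral_prod_left']
  refine lintegral_mono_ae ?_
  have hvm := hv'.1
  have hM : AEMeasurable (fun z : X × ℝ => ENNReal.ofReal (|v z| ^ p z.1)) (μ.prod ν) := by
    fun_prop
  have h1 : ∀ᵐ t ∂ν, (∫⁻ x, ENNReal.ofReal (|v (x, t)| ^ p x) ∂μ) < ⊤ := by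
    refine ae_lt_top' hM.lintegral_prod_left' ?_
    rw [← lintegral_prod_symm _ hM]
    exact hv'.2.ne
  have h2 := ae_ae_swap hvm.ae_eq_mk
  filter_upwards [h1, h2] with t ht1 ht2
  refine iInf₂_le (fun x => v (x, t)) ⟨?_, ht1⟩
  exact ⟨fun x => hvm.mk v (x, t), hvm.measurable_mk.comp measurable_prodMk_right, ht2⟩

lemma full_eq [MeasurableSpace.CountablyGenerated X] {μ : Measure X} [IsFiniteMeasure μ]
    {ν : Measure ℝ} [IsFiniteMeasure ν]
    {p : X → ℝ} (hp : Measurable p) {pp : ℝ}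
    (hae : ∀ᵐ x ∂μ, 1 ≤ p x ∧ p x ≤ pp) (φ : (X → ℝ) → ℝ≥0∞) (hzero : φ 0 ≠ ⊤)
    (hinv : ∀ w, MemVLp μ p w → ∀ w', Measurable w' → w =ᵐ[μ] w' → φ w' ≤ φ w)
    {lam : ℝ} (hlam : 0 < lam) (u : X × ℝ → ℝ)
    (hu : MemVLp (μ.prod ν) (fun z => p z.1) u) :
    (⨅ v ∈ {v : X × ℝ → ℝ | MemVLp (μ.prod ν) (fun z => p z.1) v},
      (∫⁻ z, ENNReal.ofReal (KK lam (p z.1) (v z - u z)) ∂(μ.prod ν)) +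
        ∫⁻ t, (φ fun x => v (x, t)) ∂ν)
    = ∫⁻ t, (⨅ w ∈ {w : X → ℝ | MemVLp μ p w},
          (∫⁻ x, ENNReal.ofReal (KK lam (p x) (w x - u (x, t))) ∂μ) + φ w) ∂ν := by
  refine le_antisymm ?_ (lower_bound hp φ u hu.1)
  have he := hu.1.ae_eq_mk
  have hum : vModular (μ.prod ν) (fun z => p z.1) (hu.1.mk u) < ⊤ := by
    refine lt_of_le_of_lt (le_of_eq ?_) hu.2
    unfold vModular
    refine lintegral_congr_ae ?_
    filter_upwards [he] with x hx
    rw [hx]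
  have key := upper_bound hp hae φ hzero hinv hlam (hu.1.mk u) hu.1.measurable_mk hum
  refine (le_of_eq ?_).trans (key.trans (le_of_eq ?_))
  · refine iInf_congr fun v => iInf_congr fun _ => ?_
    congr 1
    refine lintegral_congr_ae ?_
    filter_upwards [he] with x hx
    rw [hx]
  · refine lintegral_congr_ae ?_
    filter_upwards [ae_ae_swap he] with t ht
    refine iInf_congr fun w => iInf_congr fun _ => ?_
    congr 1
    refine lintegral_congr_ae ?_
    filter_upwards [ht] with x hx
    rw [hx]

end main

/-- the modified Moreau–Yosida regularization commutes with integration in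
time: `Φ_λ(u) = ∫_0^T φ_λ(Pu(t)) dt` for all `u ∈ L^{p(x)}(Q)`. -/
theorem moreau_yosida_commutes {N : ℕ} (Ω : Set (Fin N → ℝ)) (hΩ : MeasurableSet Ω)
    (hfin : volume Ω < ⊤) (T : ℝ) (hT : 0 < T)
    (p : (Fin N → ℝ) → ℝ) (hp : Measurable p) (pm pp : ℝ) (h1 : 1 < pm) (hmp : pm ≤ pp)
    (hae : ∀ᵐ x ∂(volume.restrict Ω), pm ≤ p x ∧ p x ≤ pp)
    (φ : ((Fin N → ℝ) → ℝ) → ℝ≥0∞)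
    (hzero : φ 0 ≠ ⊤)
    (hlsc : ∀ (w : (Fin N → ℝ) → ℝ) (s : ℕ → (Fin N → ℝ) → ℝ),
      MemVLp (volume.restrict Ω) p w → (∀ n, MemVLp (volume.restrict Ω) p (s n)) →
      Tendsto (fun n => luxNorm (volume.restrict Ω) p fun x => s n x - w x) atTop (𝓝 0) →
      φ w ≤ atTop.liminf fun n => φ (s n))
    (hphiconv : ∀ w v, MemVLp (volume.restrict Ω) p w → MemVLp (volume.restrict Ω) p v →
      ∀ t : ℝ, 0 ≤ t → t ≤ 1 →
      φ (fun x => t * w x + (1 - t) * v x) ≤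
        ENNReal.ofReal t * φ w + ENNReal.ofReal (1 - t) * φ v)
    (lam : ℝ) (hlam : 0 < lam)
    (u : (Fin N → ℝ) × ℝ → ℝ) (hu : MemVLp (QTmeas Ω T) (fun z => p z.1) u) :
    (⨅ v ∈ {v : (Fin N → ℝ) × ℝ → ℝ | MemVLp (QTmeas Ω T) (fun z => p z.1) v},
      (∫⁻ z, ENNReal.ofReal ((lam / p z.1) * |(v z - u z) / lam| ^ p z.1) ∂(QTmeas Ω T)) +
        ∫⁻ t in Set.Ioo (0:ℝ) T, φ fun x => v (x, t))
    = ∫⁻ t in Set.Ioo (0:ℝ) T,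
        ⨅ w ∈ {w : (Fin N → ℝ) → ℝ | MemVLp (volume.restrict Ω) p w},
          (∫⁻ x, ENNReal.ofReal ((lam / p x) * |(w x - u (x, t)) / lam| ^ p x)
              ∂(volume.restrict Ω)) + φ w := by

  have hf : IsFiniteMeasure (volume.restrict Ω) := isFiniteMeasure_restrict.2 hfin.ne
  have hae' : ∀ᵐ x ∂(volume.restrict Ω), 1 ≤ p x ∧ p x ≤ pp := by
    filter_upwards [hae] with x hx
    exact ⟨h1.le.trans hx.1, hx.2⟩
  refine full_eq (μ := volume.restrict Ω) (ν := volume.restrict (Set.Ioo (0:ℝ) T)) hp hae' φ hzero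
    ?_ hlam u hu
  intro w hw w' hw'm hww'
  have hw'mem : MemVLp (volume.restrict Ω) p w' := by
    refine ⟨hw'm.aemeasurable, lt_of_le_of_lt (le_of_eq ?_) hw.2⟩
    unfold vModular
    refine lintegral_congr_ae ?_
    filter_upwards [hww'] with x hx
    rw [hx]
  have hl := hlsc w' (fun _ => w) hw'mem (fun _ => hw) ?_
  · simpa using hl
  · have hz : luxNorm (volume.restrict Ω) p (fun x => w x - w' x) = 0 := by
      have hs : {l : ℝ | 0 < l ∧
          vModular (volume.restrict Ω) p (fun x => (w x - w' x) / l) ≤ 1} = Ioi 0 := by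
        ext l
        simp only [mem_setOf_eq, mem_Ioi, and_iff_left_iff_imp]
        intro _
        have : vModular (volume.restrict Ω) p (fun x => (w x - w' x) / l) =
            ∫⁻ _, 0 ∂(volume.restrict Ω) := by
          unfold vModular
          refine lintegral_congr_ae ?_
          filter_upwards [hww', hae'] with x hx hpx
          have : p x ≠ 0 := by linarith [hpx.1]
          simp [hx, Real.zero_rpow this]
        rw [this]; simp
      unfold luxNorm
      rw [hs, csInf_Ioi]
    simp only [hz]
    exact tendsto_const_nhds
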